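/- arXiv:math/0211335 — 2 statements merged into one kernel-verified Lean document; each statement's English description precedes it below -/
import Mathlib

section
/- Let k be a field and R = ⨁_{n≥0} R_n a commutative graded k-algebra with R_0 = k·1 which is finitely generated as a k-algebra. Then there exists a positive integer n0 such that the truncated algebra R^{[n0]} = ⨁_{n≥0} R_{n·n0} is generated as a k-algebra by its component R_{n0} of degree n0, i.e., R^{[n0]} is generated by elements of degree 1 with respect to its natural grading. -/
namespace GradedRing

section Monomials

variable {ι A σ : Type*} [Fintype ι] [CommSemiring A] [SetLike σ A]
  {𝒜 : ℕ → σ} [SetLike.GradedMonoid 𝒜] {v : ι → A} {d : ι → ℕ} {D : ℕ}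

/-- If every degree `d i` divides `D`, then a monomial of weighted degree at least
`(m + card ι) * D` is the product of an element of degree `m * D` and a monomial. -/
theorem exists_mul_prod_pow_eq (hv : ∀ i, v i ∈ 𝒜 (d i)) (hD : 0 < D) (hdvd : ∀ i, d i ∣ D)
    (m : ℕ) (a : ι → ℕ) (ha : (m + Fintype.card ι) * D ≤ ∑ i, a i * d i) :
    ∃ u ∈ 𝒜 (m * D), ∃ b : ι → ℕ,
      m * D + ∑ i, b i * d i = ∑ i, a i * d i ∧ u * ∏ i, v i ^ b i = ∏ i, v i ^ a i := by
  classical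
  induction m generalizing a with
  | zero => exact ⟨1, by simpa using SetLike.GradedOne.one_mem, a, by simp, by simp⟩
  | succ m ih =>
    obtain ⟨i, -, hi⟩ : ∃ i ∈ Finset.univ, D < a i * d i :=
      Finset.exists_lt_of_sum_lt (by simp; nlinarith)
    obtain ⟨e, he⟩ := hdvd i
    have hea : e ≤ a i := by
      by_contra! h
      nlinarith [Nat.mul_le_mul_right (d i) h.le]
    obtain ⟨c, rfl⟩ : ∃ c, a = c + (Pi.single i e : ι → ℕ) := by
      refine ⟨a - (Pi.single i e : ι → ℕ), (tsub_add_cancel_of_le fun j ↦ ?_).symm⟩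
      obtain rfl | hj := eq_or_ne j i <;> simp [*]
    have hdeg : ∑ j, (c + Pi.single i e : ι → ℕ) j * d j = ∑ j, c j * d j + D := by
      simp [add_mul, Finset.sum_add_distrib, Pi.single_apply, he, mul_comm e]
    have hprod : ∏ j, v j ^ (c + Pi.single i e : ι → ℕ) j = (∏ j, v j ^ c j) * v i ^ e := by
      simp only [Pi.add_apply, pow_add, Finset.prod_mul_distrib]
      simp [Pi.single_apply, pow_ite]
    obtain ⟨u, hu, b, hb, hub⟩ := ih c (by rw [hdeg] at ha; linarith)
    refine ⟨u * v i ^ e, ?_, b, by rw [hdeg]; linarith, by rw [hprod, ← hub]; ring⟩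
    have h := SetLike.mul_mem_graded hu (SetLike.pow_mem_graded e (hv i))
    rwa [smul_eq_mul, mul_comm e, ← he, ← Nat.succ_mul] at h

/-- If every degree `d i` divides `D` and `m ≥ card ι`, then the monomials whose weighted degree
is a positive multiple of `m * D` are products of elements of degree `m * D`. -/
theorem prod_pow_mem_closure (hv : ∀ i, v i ∈ 𝒜 (d i)) (hD : 0 < D) (hdvd : ∀ i, d i ∣ D)
    {m : ℕ} (hm : Fintype.card ι ≤ m) (n : ℕ) (a : ι → ℕ)
    (ha : ∑ i, a i * d i = (n + 1) * (m * D)) :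
    ∏ i, v i ^ a i ∈ Submonoid.closure (𝒜 (m * D) : Set A) := by
  induction n generalizing a with
  | zero =>
    refine Submonoid.subset_closure ?_
    have h := SetLike.prod_pow_mem_graded 𝒜 d v a (F := Finset.univ) fun i _ ↦ hv i
    simpa [ha] using h
  | succ n ih =>
    obtain ⟨u, hu, b, hb, hub⟩ := exists_mul_prod_pow_eq hv hD hdvd m a (by
      rw [ha]
      nlinarith [Nat.mul_le_mul_right D hm, Nat.zero_le (n * (m * D))])
    rw [← hub]
    exact mul_mem (Submonoid.subset_closure hu) (ih b (by linarith))

end Monomials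

variable {A σ : Type*} [CommRing A] [SetLike σ A] [AddSubgroupClass σ A]
  (𝒜 : ℕ → σ) [GradedRing 𝒜]

/-- A Veronese subring of a graded ring of finite type over its degree zero part is generated
in degree one. -/
theorem exists_veronese_subset_adjoin [Algebra.FiniteType (𝒜 0) A] :
    ∃ N : ℕ, 0 < N ∧ ∀ n : ℕ,
      (𝒜 (n * N) : Set A) ⊆ Algebra.adjoin (𝒜 0) (𝒜 N : Set A) := by
  obtain ⟨s, hs, hs'⟩ := GradedAlgebra.exists_finset_adjoin_eq_top_and_homogeneous_ne_zero 𝒜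
  choose d hd hv using Subtype.forall'.mp hs'
  let D := ∏ i, d i
  let m := Fintype.card s + 1
  have hD : 0 < D := Finset.prod_pos fun i _ ↦ Nat.pos_of_ne_zero (hd i)
  have hdvd (i) : d i ∣ D := Finset.dvd_prod_of_mem d (Finset.mem_univ i)
  refine ⟨m * D, by positivity, ?_⟩
  rintro (_ | n) x hx
  · rw [zero_mul] at hx
    exact Subalgebra.algebraMap_mem (Algebra.adjoin (𝒜 0) (𝒜 (m * D) : Set A)) ⟨x, hx⟩
  rw [← DirectSum.decompose_of_mem_same 𝒜 hx]
  have hspan : x ∈ Submodule.span (𝒜 0) (Submonoid.closure (Set.range ((↑) : s → A)) : Set A) := by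
    rw [← Algebra.adjoin_eq_span, Subtype.range_coe_subtype, Finset.setOfPred_mem, hs]
    trivial
  clear hx
  induction hspan using Submodule.span_induction with
  | mem x hx =>
    obtain ⟨a, rfl⟩ := Submonoid.exists_of_mem_closure_range _ _ hx
    have hmem := SetLike.prod_pow_mem_graded 𝒜 d (↑) a (F := Finset.univ) fun i _ ↦ hv i
    by_cases h : ∑ i, a i • d i = (n + 1) * (m * D)
    · rw [DirectSum.decompose_of_mem_same 𝒜 (h ▸ hmem)]
      exact (Submonoid.closure_le (S := (Algebra.adjoin (𝒜 0) _).toSubmonoid)).mpr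
        Algebra.subset_adjoin (prod_pow_mem_closure hv hD hdvd (Nat.le_succ _) n a h)
    · rw [DirectSum.decompose_of_mem_ne 𝒜 hmem h]
      exact zero_mem _
  | zero => simp
  | add x y _ _ hx hy => simpa using add_mem hx hy
  | smul r x _ hx =>
    rw [Algebra.smul_def, SetLike.GradeZero.algebraMap_apply,
      DirectSum.coe_decompose_mul_of_left_mem_zero 𝒜 r.2]
    exact Subalgebra.smul_mem _ hx r

end GradedRing

/-- Let `k` be a field and `A = ⨁_{n ≥ 0} 𝒜 n` a commutative graded `k`-algebra with
`𝒜 0 = k·1` which is finitely generated as a `k`-algebra.  Then there exists a positive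
integer `n0` such that the truncated algebra `A^{[n0]} = ⨁_{n ≥ 0} 𝒜 (n·n0)` is generated
as a `k`-algebra by its component `𝒜 n0` of degree `n0`, i.e. every graded piece
`𝒜 (n·n0)` is contained in the `k`-subalgebra generated by `𝒜 n0`. -/
theorem truncation_generated_in_degree_one
    (k A : Type*) [Field k] [CommRing A] [Algebra k A]
    (𝒜 : ℕ → Submodule k A) [GradedAlgebra 𝒜]
    (h0 : ∀ x ∈ 𝒜 0, ∃ a : k, a • (1 : A) = x)
    (hfg : (⊤ : Subalgebra k A).FG) :
    ∃ n0 : ℕ, 0 < n0 ∧ ∀ n : ℕ,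
      (𝒜 (n * n0) : Set A) ⊆ ↑(Algebra.adjoin k ((𝒜 n0 : Submodule k A) : Set A)) := by
  have : Algebra.FiniteType k A := ⟨hfg⟩
  have : IsScalarTower k (𝒜 0) A := ⟨fun r x y ↦ smul_mul_assoc r (x : A) y⟩
  have : Algebra.FiniteType (𝒜 0) A := .of_restrictScalars_finiteType k (𝒜 0) A
  obtain ⟨N, hN, h⟩ := GradedRing.exists_veronese_subset_adjoin 𝒜
  refine ⟨N, hN, fun n x hx ↦ ?_⟩
  replace hx : x ∈ Algebra.adjoin (𝒜 0) (𝒜 N : Set A) := h n hx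
  rw [SetLike.mem_coe]
  induction hx using Algebra.adjoin_induction with
  | mem x hx => exact Algebra.subset_adjoin hx
  | algebraMap r =>
    obtain ⟨a, ha⟩ := h0 r r.2
    rw [SetLike.GradeZero.algebraMap_apply, ← ha]
    exact Subalgebra.smul_mem _ (one_mem _) a
  | add x y _ _ hx hy => exact add_mem hx hy
  | mul x y _ _ hx hy => exact mul_mem hx hy
end

section
/- Let k be a field, K a field extension of k, and R a graded k-subalgebra of K[t] with R_0 = k·1 which is finitely generated as a k-algebra and satisfies R_m ≠ 0 for some m ≥ 1. Then there exists a positive integer n0 with R_{n0} ≠ 0 such that for every positive integer n and every additive valuation v on K trivial on k, one has min{ v(s) : s ∈ K^*, s·t^{n·n0} ∈ R_{n·n0} } = n · min{ v(s) : s ∈ K^*, s·t^{n0} ∈ R_{n0} }. (Both minima exist: R_{n·n0} ⊇ (R_{n0})^n is nonzero, and the graded pieces of a finitely generated graded algebra with R_0 = k are finite-dimensional over k.) -/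
open Polynomial

/-- A map on nonzero elements turning products into sums turns powers into multiples. -/
lemma map_pow_of_map_mul_eq_add {K : Type*} [Field K] {v : K → ℤ}
    (hmul : ∀ x y : K, x ≠ 0 → y ≠ 0 → v (x * y) = v x + v y) {x : K} (hx : x ≠ 0) (n : ℕ) :
    v (x ^ n) = n * v x := by
  induction n with
  | zero =>
    have h := hmul 1 1 one_ne_zero one_ne_zero
    rw [mul_one] at h
    simp only [pow_zero, Nat.cast_zero, zero_mul]
    linarith
  | succ n ih =>
    rw [pow_succ, hmul _ _ (pow_ne_zero n hx) hx, ih]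
    push_cast
    ring

/-- If the coefficients of the generators of a subalgebra of `K[t]` satisfy the linear bound
`n * w ≤ d * v (coeff n)`, then so do the coefficients of all its elements. -/
lemma coeff_bound_of_mem_adjoin {k K : Type*} [Field k] [Field K] [Algebra k K] {v : K → ℤ}
    (hmul : ∀ x y : K, x ≠ 0 → y ≠ 0 → v (x * y) = v x + v y)
    (hadd : ∀ x y : K, x ≠ 0 → y ≠ 0 → x + y ≠ 0 → min (v x) (v y) ≤ v (x + y))
    (hk : ∀ c : k, c ≠ 0 → v (algebraMap k K c) = 0)
    {S : Set K[X]} {d : ℕ} {w : ℤ}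
    (hS : ∀ p ∈ S, ∀ n : ℕ, p.coeff n = 0 ∨ (n : ℤ) * w ≤ d * v (p.coeff n))
    {p : K[X]} (hp : p ∈ Algebra.adjoin k S) (n : ℕ) :
    p.coeff n = 0 ∨ (n : ℤ) * w ≤ d * v (p.coeff n) := by
  have hsum : ∀ (n : ℕ) (x y : K), (x = 0 ∨ (n : ℤ) * w ≤ d * v x) →
      (y = 0 ∨ (n : ℤ) * w ≤ d * v y) → (x + y = 0 ∨ (n : ℤ) * w ≤ d * v (x + y)) := by
    intro n x y hx hy
    by_cases hx0 : x = 0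
    · simpa [hx0] using hy
    by_cases hy0 : y = 0
    · simpa [hy0] using hx
    by_cases hxy : x + y = 0
    · exact Or.inl hxy
    right
    have hx := hx.resolve_left hx0
    have hy := hy.resolve_left hy0
    have hd : (0 : ℤ) ≤ d := Int.natCast_nonneg d
    rcases min_le_iff.mp (hadd x y hx0 hy0 hxy) with h | h
    · exact hx.trans (mul_le_mul_of_nonneg_left h hd)
    · exact hy.trans (mul_le_mul_of_nonneg_left h hd)
  induction hp using Algebra.adjoin_induction generalizing n with
  | mem p hp => exact hS p hp n
  | algebraMap c =>
    rw [Polynomial.algebraMap_apply, coeff_C]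
    split_ifs with hn
    · by_cases hc : c = 0
      · simp [hc]
      · simp [hn, hk c hc]
    · exact Or.inl rfl
  | add p q _ _ hp hq =>
    rw [coeff_add]
    exact hsum n _ _ (hp n) (hq n)
  | mul p q _ _ hp hq =>
    rw [coeff_mul]
    refine Finset.sum_induction _ (fun x => x = 0 ∨ (n : ℤ) * w ≤ d * v x) (hsum n)
      (Or.inl rfl) fun ij hij => ?_
    rw [Finset.HasAntidiagonal.mem_antidiagonal] at hij
    by_cases hp0 : p.coeff ij.1 = 0
    · simp [hp0]
    by_cases hq0 : q.coeff ij.2 = 0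
    · simp [hq0]
    right
    have h1 := (hp ij.1).resolve_left hp0
    have h2 := (hq ij.2).resolve_left hq0
    rw [hmul _ _ hp0 hq0, ← hij]
    push_cast
    linarith


/-- Let `k` be a field, `K` a field extension of `k`, and `R` a graded `k`-subalgebra of
`K[t]` with `R_0 = k·1`, finitely generated as a `k`-algebra, and with `R_m ≠ 0` for some
`m ≥ 1`.  Then there exists a positive integer `n0` with `R_{n0} ≠ 0` such that for every
positive integer `n` and every additive valuation `v` on `K` trivial on `k`, one has
`min{ v(s) : s ∈ K^*, s·t^{n·n0} ∈ R } = n · min{ v(s) : s ∈ K^*, s·t^{n0} ∈ R }`,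
both minima existing.  (For a divisorial algebra `R = R_X(D)` and `v = ord_F` this says
`Mov(n·n0·D) = n·Mov(n0·D)`, i.e. the limit defining `P_s(D)` stabilizes.) -/
theorem stabilization_of_mobile_parts (k K : Type*) [Field k] [Field K] [Algebra k K]
    (R : Subalgebra k (Polynomial K))
    (hgraded : ∀ p ∈ R, ∀ n : ℕ, (C (p.coeff n) * X ^ n : Polynomial K) ∈ R)
    (hdeg0 : ∀ c : K, (C c : Polynomial K) ∈ R → ∃ a : k, algebraMap k K a = c)
    (hfg : R.FG)
    (hnontriv : ∃ m : ℕ, 1 ≤ m ∧ ∃ s : K, s ≠ 0 ∧ (C s * X ^ m : Polynomial K) ∈ R) :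
    ∃ n0 : ℕ, 0 < n0 ∧ (∃ s : K, s ≠ 0 ∧ (C s * X ^ n0 : Polynomial K) ∈ R) ∧
      ∀ n : ℕ, 0 < n → ∀ v : K → ℤ,
        (∀ x y : K, x ≠ 0 → y ≠ 0 → v (x * y) = v x + v y) →
        (∀ x y : K, x ≠ 0 → y ≠ 0 → x + y ≠ 0 → min (v x) (v y) ≤ v (x + y)) →
        (∀ c : k, c ≠ 0 → v (algebraMap k K c) = 0) →
        ∃ b : ℤ,
          IsLeast {m : ℤ | ∃ s : K, s ≠ 0 ∧ (C s * X ^ n0 : Polynomial K) ∈ R ∧ v s = m}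
            b ∧
          IsLeast {m : ℤ | ∃ s : K, s ≠ 0 ∧ (C s * X ^ (n * n0) : Polynomial K) ∈ R ∧
            v s = m} ((n : ℤ) * b) := by
  obtain ⟨S, rfl⟩ := hfg
  set T : Finset (Σ _ : K[X], ℕ) := S.sigma fun p => p.support.erase 0 with hT
  have hmemT : ∀ x : Σ _ : K[X], ℕ, x ∈ T ↔ x.1 ∈ S ∧ x.2 ≠ 0 ∧ x.1.coeff x.2 ≠ 0 := by
    intro x
    simp [hT]
  have hTR : ∀ x ∈ T, (C (x.1.coeff x.2) * X ^ x.2 : K[X]) ∈ Algebra.adjoin k (S : Set K[X]) :=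
    fun x hx => hgraded _ (Algebra.subset_adjoin ((hmemT x).mp hx).1) _
  have hconst : ∀ p ∈ S, ∃ a : k, algebraMap k K a = p.coeff 0 := by
    intro p hp
    refine hdeg0 _ ?_
    simpa using hgraded p (Algebra.subset_adjoin hp) 0
  have hTne : T.Nonempty := by
    by_contra hempty
    rw [Finset.not_nonempty_iff_eq_empty] at hempty
    obtain ⟨m, hm, s, hs, hsm⟩ := hnontriv
    have hbot : Algebra.adjoin k (S : Set K[X]) ≤ ⊥ := by
      refine Algebra.adjoin_le fun p hp => ?_
      obtain ⟨a, ha⟩ := hconst p hp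
      refine Algebra.mem_bot.mpr ⟨a, ?_⟩
      rw [Polynomial.algebraMap_apply, ha]
      ext n
      rw [coeff_C]
      split_ifs with hn
      · rw [hn]
      · by_contra hne
        have hmem := (hmemT ⟨p, n⟩).mpr ⟨hp, hn, Ne.symm hne⟩
        simp [hempty] at hmem
    obtain ⟨a, ha⟩ := Algebra.mem_bot.mp (hbot hsm)
    have hcoeff := congrArg (fun p : K[X] => p.coeff m) ha
    simp only [Polynomial.algebraMap_apply, coeff_C, coeff_C_mul, coeff_X_pow_self, mul_one,
      if_neg (Nat.one_le_iff_ne_zero.mp hm)] at hcoeff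
    exact hs hcoeff.symm
  have hpow : ∀ x ∈ T, ∀ e : ℕ, (C (x.1.coeff x.2 ^ e) * X ^ (x.2 * e) : K[X]) ∈
      Algebra.adjoin k (S : Set K[X]) := by
    intro x hx e
    have h := pow_mem (hTR x hx) e
    rwa [mul_pow, ← C_pow, ← pow_mul] at h
  refine ⟨∏ x ∈ T, x.2, Finset.prod_pos fun x hx => Nat.pos_of_ne_zero ((hmemT x).mp hx).2.1,
    ?_, ?_⟩
  · obtain ⟨x, hx⟩ := hTne
    obtain ⟨e, he⟩ := Finset.dvd_prod_of_mem (fun x : Σ _ : K[X], ℕ => x.2) hx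
    exact ⟨_, pow_ne_zero e ((hmemT x).mp hx).2.2, he ▸ hpow x hx e⟩
  · intro n _ v hmul hadd hk
    obtain ⟨x, hx, hmin⟩ := T.exists_min_image
      (fun x => (v (x.1.coeff x.2) : ℚ) / (x.2 : ℚ)) hTne
    obtain ⟨e, he⟩ := Finset.dvd_prod_of_mem (fun x : Σ _ : K[X], ℕ => x.2) hx
    obtain ⟨-, hd, hx0⟩ := (hmemT x).mp hx
    have hbound : ∀ p ∈ (S : Set K[X]), ∀ n : ℕ,
        p.coeff n = 0 ∨ (n : ℤ) * v (x.1.coeff x.2) ≤ x.2 * v (p.coeff n) := by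
      intro p hp n
      by_cases hpn : p.coeff n = 0
      · exact Or.inl hpn
      right
      by_cases hn : n = 0
      · subst hn
        obtain ⟨a, ha⟩ := hconst p hp
        have ha0 : a ≠ 0 := by
          rintro rfl
          exact hpn (by rw [← ha, map_zero])
        rw [← ha, hk a ha0]
        simp
      · have h := hmin ⟨p, n⟩ ((hmemT _).mpr ⟨hp, hn, hpn⟩)
        rw [div_le_div_iff₀ (Nat.cast_pos.mpr (Nat.pos_of_ne_zero hd))
          (Nat.cast_pos.mpr (Nat.pos_of_ne_zero hn))] at h
        rw [mul_comm, mul_comm (x.2 : ℤ)]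
        exact_mod_cast h
    have hleast : ∀ n : ℕ, IsLeast {m : ℤ | ∃ s : K, s ≠ 0 ∧
        (C s * X ^ (n * ∏ x ∈ T, x.2) : K[X]) ∈ Algebra.adjoin k (S : Set K[X]) ∧ v s = m}
        ((n : ℤ) * (e * v (x.1.coeff x.2))) := by
      intro n
      rw [he]
      constructor
      · refine ⟨x.1.coeff x.2 ^ (n * e), pow_ne_zero _ hx0, ?_, ?_⟩
        · rw [mul_left_comm]
          exact hpow x hx (n * e)
        · rw [map_pow_of_map_mul_eq_add hmul hx0]
          push_cast
          ring
      · rintro m ⟨s, hs, hsR, rfl⟩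
        have h := coeff_bound_of_mem_adjoin hmul hadd hk hbound hsR (n * (x.2 * e))
        rw [coeff_C_mul, coeff_X_pow_self, mul_one] at h
        have h := h.resolve_left hs
        refine le_of_mul_le_mul_left ?_ (Int.natCast_pos.mpr (Nat.pos_of_ne_zero hd))
        push_cast at h
        linarith
    exact ⟨_, by simpa only [one_mul, Nat.cast_one] using hleast 1, hleast n⟩
end
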